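/- Let R be a standard graded K-algebra, F a finitely generated graded free R-module with homogeneous basis e_1, …, e_s, and N ⊆ F a graded submodule. Then for every minimal set of homogeneous generators x_1, …, x_t of N, writing x_i = Σ_{j=1}^s a_{ij} e_j with homogeneous coefficients a_{ij} ∈ R (with the convention deg a = ∞ for a = 0), one has ρ(N,F) ≥ min_{i=1,…,t} min_{j=1,…,s} deg a_{ij}. -/

import Mathlib

open Submodule

section

variable {K A : Type*} [Field K] [CommRing A] [Algebra K A]

/-- The graded maximal ideal `m = A_+` of a (standard) graded `K`-algebra `A`,
generated by the elements of positive degree. -/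
def gradedMaxIdeal (𝒜 : ℕ → Submodule K A) : Ideal A :=
  Ideal.span (⋃ i : ℕ, (𝒜 (i + 1) : Set A))

/-- The homogeneous elements of degree `t` of the graded free module `F = ⊕_j A e_j`
over the graded algebra `A`, where the basis element `e_j` has degree `d j`:
componentwise, the `j`-th coordinate must be homogeneous of degree `t - d j`
(and `0` if `t < d j`). -/
def freeHomPiece (𝒜 : ℕ → Submodule K A) {s : ℕ} (d : Fin s → ℕ) (t : ℕ) :
    Submodule K (Fin s → A) :=
  Submodule.pi Set.univ fun j => if d j ≤ t then 𝒜 (t - d j) else ⊥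

/-- The Artin–Rees number `ρ(N, P)` with respect to an ideal `m`. -/
noncomputable def artinReesNumber {R : Type*} [CommRing R] {M : Type*} [AddCommGroup M]
    [Module R M] (m : Ideal R) (N P : Submodule R M) : ℕ :=
  sInf {r : ℕ | ∀ i : ℕ, r ≤ i → N ⊓ m ^ i • P = m ^ (i - r) • (N ⊓ m ^ r • P)}

end

section

variable {K A : Type*} [Field K] [CommRing A] [Algebra K A]

theorem mem_gradedMaxIdeal_pow (𝒜 : ℕ → Submodule K A)
    (hstd : ∀ n : ℕ, 𝒜 (n + 1) = 𝒜 n * 𝒜 1) (n : ℕ) {a : A} (ha : a ∈ 𝒜 n) :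
    a ∈ gradedMaxIdeal 𝒜 ^ n := by
  induction n generalizing a with
  | zero => simp
  | succ n ih =>
    rw [hstd] at ha
    induction ha using Submodule.mul_induction_on' with
    | mem_mul_mem b hb c hc =>
      rw [pow_succ]
      exact Ideal.mul_mem_mul (ih hb) (Ideal.subset_span (Set.mem_iUnion.2 ⟨0, hc⟩))
    | add b _ c _ hb hc => exact add_mem hb hc

theorem decompose_zero_of_mem_gradedMaxIdeal (𝒜 : ℕ → Submodule K A) [GradedAlgebra 𝒜] {a : A}
    (ha : a ∈ gradedMaxIdeal 𝒜) : (DirectSum.decompose 𝒜 a 0 : A) = 0 := by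
  suffices h : gradedMaxIdeal 𝒜 ≤ RingHom.ker (GradedRing.projZeroRingHom 𝒜) from h ha
  refine Ideal.span_le.2 fun b hb => ?_
  obtain ⟨i, hi⟩ := Set.mem_iUnion.1 hb
  exact DirectSum.decompose_of_mem_ne 𝒜 hi (Nat.succ_ne_zero i)

theorem eq_zero_of_mul_eq_zero_of_sub_one_mem (𝒜 : ℕ → Submodule K A) [GradedAlgebra 𝒜]
    {a b : A} {n : ℕ} (ha : a - 1 ∈ gradedMaxIdeal 𝒜) (hb : b ∈ 𝒜 n) (hab : a * b = 0) :
    b = 0 := by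
  have h : ((a - 1) * b) = -b := by rw [sub_mul, hab, one_mul, zero_sub]
  have h' := DirectSum.coe_decompose_mul_of_right_mem_of_le 𝒜 (a := a - 1) hb le_rfl
  rw [h, Nat.sub_self, decompose_zero_of_mem_gradedMaxIdeal 𝒜 ha, zero_mul,
    DirectSum.decompose_of_mem_same 𝒜 (neg_mem hb)] at h'
  exact neg_eq_zero.1 h'

end

theorem mem_smul_top_of_forall_mem {R ι : Type*} [CommRing R] [Fintype ι] {I : Ideal R}
    {x : ι → R} (hx : ∀ j, x j ∈ I) : x ∈ I • (⊤ : Submodule R (ι → R)) := by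
  classical
  rw [pi_eq_sum_univ x]
  exact Submodule.sum_mem _ fun j _ => Submodule.smul_mem_smul (hx j) Submodule.mem_top

theorem artinReesNumber_spec {R M : Type*} [CommRing R] [IsNoetherianRing R] [AddCommGroup M]
    [Module R M] [Module.Finite R M] (m : Ideal R) (N : Submodule R M) (i : ℕ)
    (hi : artinReesNumber m N ⊤ ≤ i) :
    N ⊓ m ^ i • ⊤ =
      m ^ (i - artinReesNumber m N ⊤) • (N ⊓ m ^ artinReesNumber m N ⊤ • ⊤) := by
  obtain ⟨k, hk⟩ := Ideal.exists_pow_inf_eq_pow_smul m N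
  refine Nat.sInf_mem (s := {r : ℕ | ∀ i : ℕ, r ≤ i →
    N ⊓ m ^ i • ⊤ = m ^ (i - r) • (N ⊓ m ^ r • ⊤)}) ⟨k, fun i hi => ?_⟩ i hi
  simpa only [inf_comm] using hk i hi

/-- Let `R` be a standard graded `K`-algebra, `F` a finitely generated
graded free `R`-module with homogeneous basis `e_1, …, e_s` (of degrees `d_1, …, d_s`), and
`N ⊆ F` a (nonzero) graded submodule.  Then for every minimal set of homogeneous generators
`x_1, …, x_t` of `N`, writing `x_i = Σ_j a_{ij} e_j`, one has
`ρ(N, F) ≥ min_i min_j deg a_{ij}` (with `deg a = ∞` for `a = 0`); i.e. there are `i, j`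
with `a_{ij} ≠ 0` and `deg a_{ij} = (deg x_i) - d_j ≤ ρ(N, F)`. -/
theorem statement4 {K A : Type*} [Field K] [CommRing A] [Algebra K A] [IsNoetherianRing A]
    (𝒜 : ℕ → Submodule K A) [GradedAlgebra 𝒜]
    (hstd : ∀ n : ℕ, 𝒜 (n + 1) = 𝒜 n * 𝒜 1)
    {s : ℕ} (d : Fin s → ℕ) (N : Submodule A (Fin s → A)) (hN : N ≠ ⊥)
    (hNgraded : ∃ T : Set (Fin s → A),
      (∀ y ∈ T, ∃ t : ℕ, y ∈ freeHomPiece 𝒜 d t) ∧ Submodule.span A T = N)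
    {t : ℕ} (x : Fin t → Fin s → A) (tdeg : Fin t → ℕ)
    (hhom : ∀ i, x i ∈ freeHomPiece 𝒜 d (tdeg i))
    (hgen : Submodule.span A (Set.range x) = N)
    (hmin : ∀ i, x i ∉ Submodule.span A (x '' {j | j ≠ i})) :
    ∃ i : Fin t, ∃ j : Fin s, x i j ≠ 0 ∧
      tdeg i - d j ≤ artinReesNumber (gradedMaxIdeal 𝒜) N ⊤ := by
  by_contra! hlarge
  have hx : ∀ i j, x i j ≠ 0 → x i j ∈ 𝒜 (tdeg i - d j) := by
    intro i j hij
    have h : x i j ∈ if d j ≤ tdeg i then 𝒜 (tdeg i - d j) else ⊥ := hhom i j (Set.mem_univ j)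
    split_ifs at h with hd
    · exact h
    · exact absurd ((Submodule.mem_bot K).1 h) hij
  set m := gradedMaxIdeal 𝒜
  set r := artinReesNumber m N ⊤
  have hNle : N ≤ m ^ (r + 1) • ⊤ := by
    rw [← hgen, Submodule.span_le]
    rintro _ ⟨i, rfl⟩
    refine mem_smul_top_of_forall_mem fun j => ?_
    by_cases hij : x i j = 0
    · rw [hij]; exact zero_mem _
    · exact Ideal.pow_le_pow_right (hlarge i j hij)
        (mem_gradedMaxIdeal_pow 𝒜 hstd _ (hx i j hij))
  have hNm : N ≤ m • N := by
    have h := artinReesNumber_spec m N (r + 1) (Nat.le_succ r)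
    rw [inf_eq_left.2 hNle, Nat.add_sub_cancel_left, pow_one] at h
    exact h.le.trans (Submodule.smul_mono le_rfl inf_le_left)
  obtain ⟨a, ha, haN⟩ := Submodule.exists_sub_one_mem_and_smul_eq_zero_of_fg_of_le_smul m N
    (IsNoetherian.noetherian N) hNm
  refine hN (le_bot_iff.1 ?_)
  rw [← hgen, Submodule.span_le]
  rintro _ ⟨i, rfl⟩
  refine (Submodule.mem_bot A).2 (funext fun j => ?_)
  by_contra hij
  exact hij (eq_zero_of_mul_eq_zero_of_sub_one_mem 𝒜 ha (hx i j hij)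
    (congrFun (haN (x i) (hgen ▸ Submodule.subset_span ⟨i, rfl⟩)) j))
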